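/- In the symmetric algebra S(q) of the abelian space q with variables Z, U, V, equipped with the Moyal product ∗ associated to the constant Poisson structure {U, V} = -Z̄ evaluated appropriately (i.e. the product with B₁(F,G) = (1/2)(∂_U F ∂_V G − ∂_V F ∂_U G)·c for the relevant structure constants), the element Ā = 2UZ − V² satisfies Ā ∗ Ā = Ā², but Ā ∗ Ā ∗ Ā = Ā³ − 2Z². -/

import Mathlib

open MvPolynomial

/-- Coordinates: variable `0 = Z`, `1 = U`, `2 = V`. -/
noncomputable def dU (p : MvPolynomial (Fin 3) ℝ) : MvPolynomial (Fin 3) ℝ :=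
  pderiv (1 : Fin 3) p

noncomputable def dV (p : MvPolynomial (Fin 3) ℝ) : MvPolynomial (Fin 3) ℝ :=
  pderiv (2 : Fin 3) p

/-- The Moyal product on `ℝ[Z,U,V]` associated to the constant structure with
`B₁(F,G) = -(1/2)(∂_U F ∂_V G − ∂_V F ∂_U G)`, so that `U ∗ V² = UV² − V` and
`V² ∗ U = V²U + V`.  The expansion terminates since `F` has bounded total degree. -/
noncomputable def moyal (F G : MvPolynomial (Fin 3) ℝ) : MvPolynomial (Fin 3) ℝ :=
  ∑ k ∈ Finset.range (F.totalDegree + 1),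
    C ((-(2 : ℝ)⁻¹) ^ k / (Nat.factorial k : ℝ)) *
      ∑ j ∈ Finset.range (k + 1),
        C ((-1 : ℝ) ^ j * (Nat.choose k j : ℝ)) *
          (dU^[k - j] (dV^[j] F) * dV^[k - j] (dU^[j] G))

/-- The element `Ā = 2UZ − V²`. -/
noncomputable def Abar : MvPolynomial (Fin 3) ℝ :=
  C 2 * (X 1 * X 0) - (X 2) ^ 2

lemma dU_zero : dU 0 = 0 := by simp [dU]

lemma dV_zero : dV 0 = 0 := by simp [dV]

lemma dU_iter_zero (n : ℕ) : dU^[n] 0 = 0 := Function.iterate_fixed dU_zero n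

lemma dV_iter_zero (n : ℕ) : dV^[n] 0 = 0 := Function.iterate_fixed dV_zero n

lemma dU_Abar : dU Abar = C 2 * X 0 := by
  simp [dU, Abar, pderiv_X, Pi.single_apply, Derivation.leibniz]

lemma dV_Abar : dV Abar = - (C 2 * X 2) := by
  simp [dV, Abar, pderiv_X, Pi.single_apply, Derivation.leibniz]
  exact (map_ofNat C 2).symm

lemma dU_C2X0 : dU (C 2 * X 0) = 0 := by
  simp [dU, pderiv_X, Pi.single_apply, Derivation.leibniz]

lemma dV_C2X0 : dV (C 2 * X 0) = 0 := by
  simp [dV, pderiv_X, Pi.single_apply, Derivation.leibniz]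

lemma dV_C2X2 : dV (-(C 2 * X 2)) = - C 2 := by
  simp [dV, pderiv_X, Pi.single_apply, Derivation.leibniz]

lemma dV_C2 : dV (- C 2) = 0 := by
  simp [dV]

lemma high_zero (k j : ℕ) (hk : 3 ≤ k) : dV^[k - j] (dU^[j] Abar) = 0 := by
  match j with
  | 0 =>
    obtain ⟨m, rfl⟩ := Nat.exists_eq_add_of_le' hk
    simp only [Nat.sub_zero, Function.iterate_succ_apply, Function.iterate_zero, id,
      dV_Abar, dV_C2X2, dV_C2, dV_iter_zero]
  | 1 =>
    obtain ⟨m, rfl⟩ := Nat.exists_eq_add_of_le' hk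
    have : m + 3 - 1 = m + 1 + 1 := by omega
    rw [this]
    simp only [Function.iterate_succ_apply, Function.iterate_zero, id,
      dU_Abar, dV_C2X0, dV_zero, dV_iter_zero]
  | j + 2 =>
    simp only [Function.iterate_succ_apply, dU_Abar, dU_C2X0, dU_iter_zero, dV_iter_zero]

lemma moyal_Abar (F : MvPolynomial (Fin 3) ℝ) (hF : 2 ≤ F.totalDegree) :
    moyal F Abar = F * Abar + C (-(2 : ℝ)⁻¹) * (dU F * (-(C 2 * X 2)) - dV F * (C 2 * X 0))
      - C (1 / 4 : ℝ) * dU (dU F) := by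
  unfold moyal
  rw [← Finset.sum_subset (s₁ := Finset.range 3)]
  · simp only [Finset.sum_range_succ, Finset.sum_range_zero, Function.iterate_succ_apply,
      Function.iterate_zero, id, dU_Abar, dV_Abar, dU_C2X0, dV_C2X0, dV_C2X2,
      Nat.sub_zero, Nat.sub_self, Nat.reduceSub, Nat.reduceAdd]
    have h8 : (C ((-(2 : ℝ)⁻¹) ^ 2 / (Nat.factorial 2 : ℝ)) : MvPolynomial (Fin 3) ℝ) * C 2
        = C (1 / 4 : ℝ) := by
      rw [← C_mul]; norm_num [Nat.factorial]
    rw [← h8]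
    simp [Nat.choose, Nat.factorial]
    ring
  · intro x hx
    simp only [Finset.mem_range] at *
    omega
  · intro k _ hk
    have hk' : 3 ≤ k := by simpa using hk
    simp [high_zero _ _ hk']

lemma deg_Abar : 2 ≤ Abar.totalDegree := by
  have h : Finsupp.single (2 : Fin 3) 2 ∈ Abar.support := by
    rw [mem_support_iff]
    have : coeff (Finsupp.single (2 : Fin 3) 2) (C (2:ℝ) * (X 1 * X 0 : MvPolynomial (Fin 3) ℝ)) = 0 := by
      rw [coeff_C_mul, coeff_mul_X']
      simp
    rw [Abar, coeff_sub, this, coeff_X_pow]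
    simp
  simpa using le_totalDegree h

lemma Abar_ne : Abar ≠ 0 := by
  intro h
  have := deg_Abar
  simp [h] at this

lemma deg_Abar_sq : 2 ≤ (Abar ^ 2).totalDegree := by
  rw [pow_two, totalDegree_mul_of_isDomain Abar_ne Abar_ne]
  have := deg_Abar
  omega

lemma dU_sq : dU (Abar ^ 2) = C 2 * Abar * (C 2 * X 0) := by
  have := dU_Abar
  unfold dU at *
  rw [pow_two, Derivation.leibniz, this]
  simp only [smul_eq_mul, map_ofNat]
  ring

lemma dV_sq : dV (Abar ^ 2) = C 2 * Abar * (-(C 2 * X 2)) := by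
  have := dV_Abar
  unfold dV at *
  rw [pow_two, Derivation.leibniz, this]
  simp only [smul_eq_mul, map_ofNat]
  ring

lemma dU_dU_sq : dU (dU (Abar ^ 2)) = C 8 * X 0 ^ 2 := by
  rw [dU_sq]
  have h1 := dU_Abar
  have h2 := dU_C2X0
  unfold dU at *
  rw [Derivation.leibniz, h2, Derivation.leibniz, h1, pderiv_C]
  simp only [smul_eq_mul, map_ofNat]
  ring

/-- `Ā ∗ Ā = Ā²` but `Ā ∗ Ā ∗ Ā = Ā³ − 2Z²` for the Moyal product. -/
theorem stmt_8 :
    moyal Abar Abar = Abar ^ 2 ∧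
    moyal (moyal Abar Abar) Abar = Abar ^ 3 - C 2 * (X 0) ^ 2 := by
  have h1 : moyal Abar Abar = Abar ^ 2 := by
    rw [moyal_Abar _ deg_Abar, dU_Abar, dV_Abar, dU_C2X0]
    ring
  refine ⟨h1, ?_⟩
  rw [h1, moyal_Abar _ deg_Abar_sq, dU_dU_sq, dU_sq, dV_sq]
  have h : (C (1 / 4 : ℝ) * (C 8 * X 0 ^ 2) : MvPolynomial (Fin 3) ℝ) = C 2 * X 0 ^ 2 := by
    rw [← mul_assoc, ← C_mul]; norm_num
  rw [h]
  ring
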